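/- arXiv:1510.06142 — 5 statements merged into one kernel-verified Lean document; each statement's English description precedes it below -/
import Mathlib

section
/- Let M be a real m×n matrix with rank(M) = r, where 1 ≤ r ≤ min(m,n), and let B be a random n×r Gaussian matrix. Then, almost surely with respect to the Gaussian measure on n×r matrices, rank(MB) = r, and consequently range(MB) = range(M) almost surely. -/
open MeasureTheory ProbabilityTheory

/-- The standard Gaussian measure on `p × q` real matrices (represented as functions
`Fin p → Fin q → ℝ`): the product measure all of whose entry marginals are `N(0,1)`. -/
noncomputable def gaussianMatrix (p q : ℕ) : Measure (Fin p → Fin q → ℝ) :=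
  Measure.pi fun _ : Fin p => Measure.pi fun _ : Fin q => gaussianReal 0 1

/-- A finite product of absolutely continuous measures is absolutely continuous. -/
theorem absolutelyContinuous_pi_fin {k : ℕ} {α : Fin k → Type*} [∀ i, MeasurableSpace (α i)]
    {μ ν : ∀ i, Measure (α i)} [∀ i, SigmaFinite (μ i)] [∀ i, SigmaFinite (ν i)]
    (h : ∀ i, (μ i).AbsolutelyContinuous (ν i)) :
    (Measure.pi μ).AbsolutelyContinuous (Measure.pi ν) := by
  induction k with
  | zero => rw [Measure.pi_of_empty μ, Measure.pi_of_empty ν]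
  | succ k ih =>
    rw [← (measurePreserving_piFinSuccAbove μ 0).symm.map_eq,
      ← (measurePreserving_piFinSuccAbove ν 0).symm.map_eq]
    exact ((h 0).prod (ih fun i => h _)).map (MeasurableEquiv.measurable _)

theorem gaussianMatrix_absolutelyContinuous (p q : ℕ) :
    (gaussianMatrix p q).AbsolutelyContinuous volume :=
  absolutelyContinuous_pi_fin fun _ => absolutelyContinuous_pi_fin fun _ =>
    gaussianReal_absolutelyContinuous 0 one_ne_zero

/-- A pencil `A + t • D` with `D` invertible is singular for only finitely many `t`. -/
theorem ae_det_add_smul_ne_zero {ι : Type*} [Fintype ι] [DecidableEq ι] (A D : Matrix ι ι ℝ)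
    (hD : D.det ≠ 0) : ∀ᵐ t : ℝ, (A + t • D).det ≠ 0 := by
  set P : Polynomial ℝ :=
    ((Polynomial.X : Polynomial ℝ) • D.map Polynomial.C + A.map Polynomial.C).det with hP
  have hP0 : P ≠ 0 := fun h => hD <| by
    rw [← Polynomial.coeff_det_X_add_C_card D A, ← hP, h, Polynomial.coeff_zero]
  have heval (t : ℝ) : P.eval t = (A + t • D).det := by
    rw [hP, ← Polynomial.coe_evalRingHom, RingHom.map_det]
    congr 1
    ext i j
    simp [add_comm, mul_comm t]
  filter_upwards [measure_eq_zero_iff_ae_notMem.1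
    (P.roots.toFinset.finite_toSet.measure_zero volume)] with t ht h
  exact ht (by simp [hP0, heval, h])

/-- If `K * W` is invertible for some `W`, then `K * B` is invertible for almost all `B`. -/
theorem ae_det_mul_of_ne_zero {n r : ℕ} (K : Matrix (Fin r) (Fin n) ℝ)
    (W : Matrix (Fin n) (Fin r) ℝ) (hW : (K * W).det ≠ 0) :
    ∀ᵐ B : Fin n → Fin r → ℝ, (K * Matrix.of B).det ≠ 0 := by
  have hcont : Continuous fun B : Fin n → Fin r → ℝ => (K * Matrix.of B).det :=
    (continuous_const.matrix_mul (A := fun _ => K) continuous_id).matrix_det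
  refine ae_mem_of_ae_add_linearMap_mem
    (LinearMap.toSpanSingleton ℝ (Fin n → Fin r → ℝ) W) volume volume
    (s := {B | (K * Matrix.of B).det ≠ 0})
    (hcont.isOpen_preimage _ isOpen_ne).measurableSet fun B => ?_
  filter_upwards [ae_det_add_smul_ne_zero (K * Matrix.of B) (K * W) hW] with t ht
  rw [← Matrix.mul_smul, ← Matrix.mul_add] at ht
  exact ht

/-- A matrix of rank `r` can be compressed on both sides to the identity of size `r`. -/
theorem exists_mul_mul_eq_one_of_rank_eq {m n r : ℕ} (M : Matrix (Fin m) (Fin n) ℝ)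
    (hM : M.rank = r) :
    ∃ (C : Matrix (Fin r) (Fin m) ℝ) (W : Matrix (Fin n) (Fin r) ℝ), C * M * W = 1 := by
  let e : (Fin r → ℝ) ≃ₗ[ℝ] LinearMap.range M.mulVecLin :=
    LinearEquiv.ofFinrankEq _ _ (by rw [Module.finrank_fin_fun]; exact hM.symm)
  obtain ⟨s, hs⟩ := M.mulVecLin.rangeRestrict.exists_rightInverse_of_surjective
    M.mulVecLin.range_rangeRestrict
  obtain ⟨c, hc⟩ := ((LinearMap.range M.mulVecLin).subtype ∘ₗ e.toLinearMap)
    |>.exists_leftInverse_of_injective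
    (LinearMap.ker_eq_bot.2 (Subtype.val_injective.comp e.injective))
  refine ⟨LinearMap.toMatrix' c, LinearMap.toMatrix' (s ∘ₗ e.toLinearMap), ?_⟩
  apply Matrix.toLin'.injective
  rw [Matrix.toLin'_mul, Matrix.toLin'_mul, Matrix.toLin'_toMatrix', Matrix.toLin'_toMatrix',
    Matrix.toLin'_one]
  ext1 i
  ext1
  have h1 : M.mulVecLin (s (e (Pi.single i 1))) = e (Pi.single i 1) :=
    congrArg Subtype.val (LinearMap.congr_fun hs (e (Pi.single i 1)))
  have h2 := LinearMap.congr_fun hc (Pi.single i 1)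
  simp only [LinearMap.comp_apply, Submodule.subtype_apply, LinearEquiv.coe_coe,
    LinearMap.id_apply] at h2
  simp only [LinearMap.comp_apply, LinearEquiv.coe_coe, LinearMap.single_apply, LinearMap.id_apply]
  rw [Matrix.toLin'_apply', h1, h2]

/-- Let `M` be a real `m×n` matrix with `rank M = r`, `1 ≤ r ≤ min(m,n)`, and
let `B` be a random `n×r` Gaussian matrix.  Then almost surely `rank (M*B) = r` and consequently
`range (M*B) = range M`. -/
theorem stmt3 {m n r : ℕ} (hr1 : 1 ≤ r) (hrm : r ≤ m) (hrn : r ≤ n)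
    (M : Matrix (Fin m) (Fin n) ℝ) (hrankM : M.rank = r) :
    ∀ᵐ B ∂(gaussianMatrix n r),
      (M * Matrix.of B).rank = r ∧
      LinearMap.range (M * Matrix.of B).mulVecLin = LinearMap.range M.mulVecLin := by
  obtain ⟨C, W, hCW⟩ := exists_mul_mul_eq_one_of_rank_eq M hrankM
  have hae := ae_det_mul_of_ne_zero (C * M) W (by simp [hCW])
  filter_upwards [(gaussianMatrix_absolutelyContinuous n r).ae_le hae] with B hB
  have hrank : (M * Matrix.of B).rank = r := by
    refine le_antisymm ((Matrix.rank_mul_le_left _ _).trans_eq hrankM) ?_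
    have h := Matrix.rank_of_isUnit _ ((Matrix.isUnit_iff_isUnit_det _).2 (isUnit_iff_ne_zero.2 hB))
    rw [Fintype.card_fin, Matrix.mul_assoc] at h
    exact h.symm.trans_le (Matrix.rank_mul_le_right _ _)
  refine ⟨hrank, Submodule.eq_of_le_of_finrank_eq ?_ (hrank.trans hrankM.symm)⟩
  rw [Matrix.mulVecLin_mul]
  exact LinearMap.range_comp_le_range _ _
end

section
/- Let M be a real m×n matrix with rank(M) = r, where 1 ≤ r ≤ min(m,n), let S be a nonempty finite set of real numbers, and let B be a random n×r matrix whose entries are i.i.d. random variables sampled uniformly from S. Then rank(MB) = r (equivalently, range(MB) = range(M)) with probability at least 1 − r/|S|, where |S| is the cardinality of S. -/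
open MeasureTheory

/-- The product measure on `p × q` real matrices (represented as functions `Fin p → Fin q → ℝ`)
whose entries are i.i.d. uniform on the nonempty finite set `S ⊂ ℝ`. -/
noncomputable def uniformMatrix (p q : ℕ) (S : Finset ℝ) (hS : S.Nonempty) :
    Measure (Fin p → Fin q → ℝ) :=
  Measure.pi fun _ : Fin p => Measure.pi fun _ : Fin q => (PMF.uniformOfFinset S hS).toMeasure

/-- The kernel of a matrix of rank `r` lies in that of some `r × n` matrix with a right inverse. -/
theorem Matrix.exists_rightInverse_and_ker_le_of_rank_eq {m n r : ℕ}
    (M : Matrix (Fin m) (Fin n) ℝ) (hM : M.rank = r) :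
    ∃ (R : Matrix (Fin r) (Fin n) ℝ) (T : Matrix (Fin n) (Fin r) ℝ), R * T = 1 ∧
      ∀ v, M.mulVec v = 0 → R.mulVec v = 0 := by
  have hfin : Module.finrank ℝ (LinearMap.range M.mulVecLin) =
      Module.finrank ℝ (Fin r → ℝ) := by
    rw [Module.finrank_fin_fun]
    exact hM
  let e := LinearEquiv.ofFinrankEq _ _ hfin
  let f : (Fin n → ℝ) →ₗ[ℝ] (Fin r → ℝ) := e.toLinearMap ∘ₗ M.mulVecLin.rangeRestrict
  have hf : LinearMap.range f = ⊤ :=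
    LinearMap.range_eq_top.2 (e.surjective.comp M.mulVecLin.surjective_rangeRestrict)
  obtain ⟨g, hg⟩ := f.exists_rightInverse_of_surjective hf
  refine ⟨LinearMap.toMatrix' f, LinearMap.toMatrix' g, ?_, fun v hv => ?_⟩
  · rw [← LinearMap.toMatrix'_comp, hg, LinearMap.toMatrix'_id]
  · have hv' : M.mulVecLin.rangeRestrict v = 0 := Subtype.ext hv
    rw [LinearMap.toMatrix'_mulVec]
    simp [f, hv']

/-- If `R * B` is invertible and `ker M ≤ ker R`, then `B` maps onto a complement of `ker M`. -/
theorem Matrix.rank_mul_eq_and_range_mul_eq_of_det_ne_zero {m n r : ℕ}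
    {M : Matrix (Fin m) (Fin n) ℝ} (hM : M.rank = r) {R : Matrix (Fin r) (Fin n) ℝ}
    (hR : ∀ v, M.mulVec v = 0 → R.mulVec v = 0) {B : Matrix (Fin n) (Fin r) ℝ}
    (hB : (R * B).det ≠ 0) :
    (M * B).rank = r ∧
      LinearMap.range (M * B).mulVecLin = LinearMap.range M.mulVecLin := by
  have hinj : Function.Injective (M * B).mulVecLin := by
    rw [← LinearMap.ker_eq_bot, LinearMap.ker_eq_bot']
    intro v hv
    rw [Matrix.mulVecLin_apply, ← Matrix.mulVec_mulVec] at hv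
    apply Matrix.eq_zero_of_mulVec_eq_zero hB
    rw [← Matrix.mulVec_mulVec]
    exact hR _ hv
  have hrank : (M * B).rank = r := by
    rw [Matrix.rank, LinearMap.finrank_range_of_inj hinj, Module.finrank_fin_fun]
  refine ⟨hrank, Submodule.eq_of_le_of_finrank_eq ?_ (hrank.trans hM.symm)⟩
  rw [Matrix.mulVecLin_mul]
  exact LinearMap.range_comp_le_range _ _

/-- The generic `n × r` matrix, with entries indexed by `Fin (n * r)`. -/
noncomputable def genericMatrix (n r : ℕ) :
    Matrix (Fin n) (Fin r) (MvPolynomial (Fin (n * r)) ℝ) :=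
  Matrix.of fun i j => MvPolynomial.X (finProdFinEquiv (i, j))

/-- The polynomial `det (R * X)`, where `X` is a generic `n × r` matrix. -/
noncomputable def detMulGeneric {n r : ℕ} (R : Matrix (Fin r) (Fin n) ℝ) :
    MvPolynomial (Fin (n * r)) ℝ :=
  (R.map (MvPolynomial.C (σ := Fin (n * r))) * genericMatrix n r).det

theorem eval_detMulGeneric {n r : ℕ} (R : Matrix (Fin r) (Fin n) ℝ) (x : Fin (n * r) → ℝ) :
    MvPolynomial.eval x (detMulGeneric R) =
      (R * Matrix.of fun i j => x (finProdFinEquiv (i, j))).det := by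
  rw [detMulGeneric, RingHom.map_det, RingHom.mapMatrix_apply, Matrix.map_mul]
  congr 2
  · ext i j
    simp
  · ext i j
    simp [genericMatrix]

theorem detMulGeneric_ne_zero {n r : ℕ} {R : Matrix (Fin r) (Fin n) ℝ}
    {T : Matrix (Fin n) (Fin r) ℝ} (h : R * T = 1) : detMulGeneric R ≠ 0 := by
  intro h0
  have := eval_detMulGeneric R fun k => T (finProdFinEquiv.symm k).1 (finProdFinEquiv.symm k).2
  simp only [h0, map_zero, Equiv.symm_apply_apply] at this
  change 0 = (R * T).det at this
  simp [h] at this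

theorem totalDegree_detMulGeneric_le {n r : ℕ} (R : Matrix (Fin r) (Fin n) ℝ) :
    (detMulGeneric R).totalDegree ≤ r := by
  apply MvPolynomial.IsHomogeneous.totalDegree_le
  rw [detMulGeneric, Matrix.det_apply']
  refine MvPolynomial.IsHomogeneous.sum _ _ _ fun σ _ => ?_
  have hprod : (∏ i, (R.map (MvPolynomial.C (σ := Fin (n * r))) * genericMatrix n r) (σ i) i).IsHomogeneous
      (∑ _i : Fin r, 1) := by
    refine MvPolynomial.IsHomogeneous.prod _ _ _ fun i _ => ?_
    rw [Matrix.mul_apply]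
    refine MvPolynomial.IsHomogeneous.sum _ _ _ fun k _ => ?_
    exact (MvPolynomial.isHomogeneous_X ℝ _).C_mul _
  have hsign : (((Equiv.Perm.sign σ : ℤ)) : MvPolynomial (Fin (n * r)) ℝ) =
      MvPolynomial.C ((Equiv.Perm.sign σ : ℤ) : ℝ) := by simp
  rw [hsign]
  simpa using hprod.C_mul ((Equiv.Perm.sign σ : ℤ) : ℝ)

theorem uniformMatrix_singleton {p q : ℕ} {S : Finset ℝ} (hS : S.Nonempty)
    {B : Fin p → Fin q → ℝ} (hB : ∀ i j, B i j ∈ S) :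
    uniformMatrix p q S hS {B} = ((S.card : ENNReal)⁻¹) ^ (p * q) := by
  have hentry : ∀ i j, (PMF.uniformOfFinset S hS).toMeasure {B i j} = (S.card : ENNReal)⁻¹ := by
    intro i j
    rw [PMF.toMeasure_apply_singleton _ _ (measurableSet_singleton _),
      PMF.uniformOfFinset_apply_of_mem hS (hB i j)]
  simp only [uniformMatrix, Measure.pi_singleton, hentry, Finset.prod_const, Finset.card_univ,
    Fintype.card_fin]
  rw [← pow_mul, mul_comm]

/-- The Schwartz–Zippel bound for a random matrix with independent entries uniform on `S`. -/
theorem one_sub_totalDegree_div_le_uniformMatrix {n r : ℕ} {S : Finset ℝ} (hS : S.Nonempty)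
    {P : MvPolynomial (Fin (n * r)) ℝ} (hP : P ≠ 0) {A : Set (Fin n → Fin r → ℝ)}
    (hA : ∀ x : Fin (n * r) → ℝ, MvPolynomial.eval x P ≠ 0 →
      (fun i j => x (finProdFinEquiv (i, j))) ∈ A) :
    1 - (P.totalDegree : ℝ) / S.card ≤ (uniformMatrix n r S hS A).toReal := by
  classical
  have : IsProbabilityMeasure (uniformMatrix n r S hS) := by
    unfold uniformMatrix
    infer_instance
  let E : (Fin (n * r) → ℝ) → Fin n → Fin r → ℝ := fun x i j => x (finProdFinEquiv (i, j))
  have hE : Function.Injective E := by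
    intro x y h
    funext k
    obtain ⟨⟨i, j⟩, rfl⟩ := finProdFinEquiv.surjective k
    exact congrFun (congrFun h i) j
  let U := Fintype.piFinset fun _ : Fin (n * r) => S
  let G := U.filter fun x => ¬ MvPolynomial.eval x P = 0
  have hmeas : uniformMatrix n r S hS (G.image E : Finset _) =
      G.card * ((S.card : ENNReal)⁻¹) ^ (n * r) := by
    rw [← sum_measure_singleton, Finset.sum_image hE.injOn, Finset.sum_congr rfl, Finset.sum_const,
      nsmul_eq_mul]
    intro x hx
    have hx' := Fintype.mem_piFinset.1 (Finset.mem_filter.1 hx).1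
    exact uniformMatrix_singleton hS fun i j => hx' _
  have hsub : ((G.image E : Finset _) : Set _) ⊆ A := by
    intro B hB
    obtain ⟨x, hx, rfl⟩ := Finset.mem_image.1 (Finset.mem_coe.1 hB)
    exact hA x (Finset.mem_filter.1 hx).2
  have hcard : (U.filter fun x => MvPolynomial.eval x P = 0).card + G.card =
      S.card ^ (n * r) := by
    rw [Finset.card_filter_add_card_filter_not]
    simp [U]
  have hcardR : ((U.filter fun x => MvPolynomial.eval x P = 0).card : ℝ) + G.card =
      (S.card : ℝ) ^ (n * r) := by exact_mod_cast hcard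
  have hSZ : ((U.filter fun x => MvPolynomial.eval x P = 0).card : ℝ) /
      (S.card : ℝ) ^ (n * r) ≤ (P.totalDegree : ℝ) / S.card := by
    have h := (NNRat.cast_le (K := ℝ)).2 (MvPolynomial.schwartz_zippel_totalDegree hP S)
    push_cast at h
    exact h
  have hpos : (0 : ℝ) < (S.card : ℝ) ^ (n * r) := by
    have := hS.card_pos
    positivity
  calc 1 - (P.totalDegree : ℝ) / S.card
      ≤ 1 - ((U.filter fun x => MvPolynomial.eval x P = 0).card : ℝ) /
          (S.card : ℝ) ^ (n * r) := by linarith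
    _ = (G.card : ℝ) * ((S.card : ℝ)⁻¹) ^ (n * r) := by
        rw [inv_pow]
        field_simp
        linarith
    _ = (uniformMatrix n r S hS (G.image E : Finset _)).toReal := by
        rw [hmeas]
        simp
    _ ≤ (uniformMatrix n r S hS A).toReal :=
        ENNReal.toReal_mono (measure_ne_top _ _) (measure_mono hsub)

/-- Let `M` be a real `m×n` matrix with `rank M = r`, `1 ≤ r ≤ min(m,n)`, let
`S` be a nonempty finite set of reals, and let `B` be a random `n×r` matrix with i.i.d. entries
uniform on `S`.  Then `rank (M*B) = r` (equivalently `range (M*B) = range M`) with probability at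
least `1 - r/|S|`. -/
theorem stmt4 {m n r : ℕ} (hr1 : 1 ≤ r) (hrm : r ≤ m) (hrn : r ≤ n)
    (M : Matrix (Fin m) (Fin n) ℝ) (hrankM : M.rank = r)
    (S : Finset ℝ) (hS : S.Nonempty) :
    1 - (r : ℝ) / S.card ≤
      ((uniformMatrix n r S hS)
        {B | (M * Matrix.of B).rank = r ∧
             LinearMap.range (M * Matrix.of B).mulVecLin =
               LinearMap.range M.mulVecLin}).toReal := by
  obtain ⟨R, T, hRT, hR⟩ := M.exists_rightInverse_and_ker_le_of_rank_eq hrankM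
  have hdeg : ((detMulGeneric R).totalDegree : ℝ) / S.card ≤ (r : ℝ) / S.card := by
    gcongr
    exact totalDegree_detMulGeneric_le R
  refine (sub_le_sub_left hdeg 1).trans
    (one_sub_totalDegree_div_le_uniformMatrix hS (detMulGeneric_ne_zero hRT) fun x hx => ?_)
  rw [eval_detMulGeneric] at hx
  exact Matrix.rank_mul_eq_and_range_mul_eq_of_det_ne_zero hrankM hR hx
end

section
/- Let M be a real m×n matrix with rank(M) = r, where 1 ≤ r ≤ min(m,n), and let B be a random n×r Gaussian matrix. Then, almost surely, the r×r matrix (MB)ᵀ(MB) is invertible and (MB)((MB)ᵀ(MB))⁻¹(MB)ᵀM = M; that is, with probability 1 the algorithm that projects M onto the column space of MB reproduces M exactly. -/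
open MeasureTheory ProbabilityTheory Matrix

/-- If every coordinate slice of a measurable function on a finite power of `X` either vanishes
identically or is almost everywhere nonzero, and the function is not identically zero, then it is
almost everywhere nonzero for the product measure. -/
theorem ae_pi_ne_zero_of_slices {X : Type*} [MeasurableSpace X] (μ : Measure X) [SigmaFinite μ]
    {n : ℕ} (F : (Fin n → X) → ℝ) (hF : Measurable F)
    (hslice : ∀ x i, (∃ t, F (Function.update x i t) ≠ 0) →
      ∀ᵐ t ∂μ, F (Function.update x i t) ≠ 0)
    (hne : ∃ x, F x ≠ 0) :
    ∀ᵐ x ∂(Measure.pi fun _ : Fin n => μ), F x ≠ 0 := by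
  induction n with
  | zero =>
    obtain ⟨x, hx⟩ := hne
    exact Filter.Eventually.of_forall fun y => by rwa [Subsingleton.elim y x]
  | succ n ih =>
    obtain ⟨x, hx⟩ := hne
    have hmp := (measurePreserving_piFinSuccAbove (fun _ : Fin (n + 1) => μ) 0).symm
    rw [← hmp.map_eq]
    have hset : MeasurableSet {x | F x ≠ 0} := hF (measurableSet_singleton 0).compl
    rw [ae_map_iff hmp.measurable.aemeasurable hset]
    have hcons : ∀ p : X × (Fin n → X),
        (MeasurableEquiv.piFinSuccAbove (fun _ : Fin (n + 1) => X) 0).symm p =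
          Fin.cons p.1 p.2 := by
      intro p
      simp [MeasurableEquiv.piFinSuccAbove, Fin.insertNthEquiv]
    have hmeas : Measurable fun p : X × (Fin n → X) =>
        (Fin.cons p.1 p.2 : Fin (n + 1) → X) := by
      simpa only [← hcons] using hmp.measurable
    simp only [hcons]
    refine (Measure.ae_prod_iff_ae_ae (p := fun p : X × (Fin n → X) => F (Fin.cons p.1 p.2) ≠ 0)
      (hmeas hset)).2 ?_
    have hfirst : ∀ᵐ t ∂μ, F (Fin.cons t (Fin.tail x)) ≠ 0 := by
      have h := hslice x 0 ⟨x 0, by rwa [Function.update_eq_self]⟩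
      filter_upwards [h] with t ht
      rwa [← Fin.cons_self_tail x, Fin.update_cons_zero] at ht
    filter_upwards [hfirst] with t ht
    refine ih (fun y => F (Fin.cons t y)) (hF.comp (hmeas.comp measurable_prodMk_left)) ?_ ⟨_, ht⟩
    intro y i
    simpa only [Fin.cons_update] using hslice (Fin.cons t y) i.succ

/-- A nonzero real polynomial is almost everywhere nonzero for an atomless measure. -/
theorem ae_eval_ne_zero (μ : Measure ℝ) [NullSingletonClass μ] (p : Polynomial ℝ)
    (hp : p ≠ 0) : ∀ᵐ t ∂μ, p.eval t ≠ 0 := by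
  have h : {t | p.eval t = 0}.Finite := by
    simpa [Polynomial.IsRoot] using Polynomial.finite_setOfPred_isRoot hp
  simpa using h.countable.ae_notMem μ

/-- The Gram determinant of `M * B` is polynomial in each entry of `B`. -/
theorem exists_polynomial_gram_det {m n r : ℕ} (M : Matrix (Fin m) (Fin n) ℝ)
    (B : Fin n → Fin r → ℝ) (i : Fin n) (b : Fin r → ℝ) (j : Fin r) :
    ∃ p : Polynomial ℝ, ∀ t, p.eval t =
      ((M * of (Function.update B i (Function.update b j t)))ᵀ *
        (M * of (Function.update B i (Function.update b j t)))).det := by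
  let P : Matrix (Fin n) (Fin r) (Polynomial ℝ) :=
    of (Function.update (fun k l => Polynomial.C (B k l)) i
      (Function.update (fun l => Polynomial.C (b l)) j Polynomial.X))
  refine ⟨((M.map Polynomial.C * P)ᵀ * (M.map Polynomial.C * P)).det, fun t => ?_⟩
  have hP : P.map (Polynomial.evalRingHom t) =
      of (Function.update B i (Function.update b j t)) := by
    ext k l
    by_cases hk : k = i
    · subst hk
      by_cases hl : l = j
      · subst hl; simp [P]
      · simp [P, hl]
    · simp [P, hk]
  have hM : (M.map Polynomial.C).map (Polynomial.evalRingHom t) = M := by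
    ext k l
    simp
  rw [← Polynomial.coe_evalRingHom, RingHom.map_det, RingHom.mapMatrix_apply, Matrix.map_mul,
    transpose_map, Matrix.map_mul, hM, hP]

/-- Some matrix `B` with `rank M` columns makes the Gram matrix of `M * B` nonsingular. -/
theorem exists_gram_det_ne_zero {m n r : ℕ} (M : Matrix (Fin m) (Fin n) ℝ) (hM : M.rank = r) :
    ∃ B : Fin n → Fin r → ℝ, ((M * of B)ᵀ * (M * of B)).det ≠ 0 := by
  have hM' : Module.finrank ℝ (LinearMap.range M.mulVecLin) = r := hM
  obtain ⟨b⟩ : Nonempty (Module.Basis (Fin r) ℝ (LinearMap.range M.mulVecLin)) :=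
    ⟨Module.finBasisOfFinrankEq ℝ _ hM'⟩
  choose v hv using fun k => LinearMap.mem_range.1 (b k).2
  refine ⟨fun i k => v k i, ?_⟩
  have hcol : (M * of fun i k => v k i).col = fun k => (b k : Fin m → ℝ) := by
    ext k i
    rw [← hv k]
    rfl
  have hli : LinearIndependent ℝ (M * of fun i k => v k i).col := by
    rw [hcol]
    exact b.linearIndependent.map' _ (Submodule.ker_subtype _)
  generalize M * of (fun i k => v k i) = G at hli ⊢
  refine ((isUnit_iff_isUnit_det _).1 (mulVec_injective_iff_isUnit.1 ?_)).ne_zero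
  rw [← mulVec_injective_iff, ← coe_mulVecLin, ← LinearMap.ker_eq_bot] at hli
  rw [← coe_mulVecLin, ← LinearMap.ker_eq_bot, ker_mulVecLin_transpose_mul_self, hli]

/-- If the Gram matrix of `M * B` is invertible and `B` has `rank M` columns, then projecting `M`
onto the column space of `M * B` gives back `M`. -/
theorem proj_mul_eq_self_of_isUnit_gram {m n r : ℕ} (M : Matrix (Fin m) (Fin n) ℝ)
    (hM : M.rank = r) (B : Matrix (Fin n) (Fin r) ℝ) (hB : IsUnit ((M * B)ᵀ * (M * B))) :
    (M * B) * ((M * B)ᵀ * (M * B))⁻¹ * (M * B)ᵀ * M = M := by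
  have hrank : (M * B).rank = r := by
    rw [← rank_transpose_mul_self, rank_of_isUnit _ hB, Fintype.card_fin]
  have hrange : LinearMap.range (M * B).mulVecLin = LinearMap.range M.mulVecLin := by
    refine Submodule.eq_of_le_of_finrank_eq ?_ (hrank.trans hM.symm)
    rw [mulVecLin_mul]
    exact LinearMap.range_comp_le_range _ _
  have hmem : ∀ k, ∃ c, (M * B).mulVecLin c = M.col k := by
    intro k
    rw [← LinearMap.mem_range, hrange]
    exact ⟨Pi.single k 1, by simp⟩
  choose c hc using hmem
  have hfac : M * B * of (fun l k => c k l) = M := by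
    ext i k
    exact congrFun (hc k) i
  have hdet := (isUnit_iff_isUnit_det _).1 hB
  generalize M * B = G at *
  rw [← hfac, ← Matrix.mul_assoc, Matrix.mul_assoc _ Gᵀ G, Matrix.mul_assoc G,
    nonsing_inv_mul _ hdet, Matrix.mul_one]

/-- Let `M` be a real `m×n` matrix with `rank M = r`, `1 ≤ r ≤ min(m,n)`, and
let `B` be a random `n×r` Gaussian matrix.  Then, almost surely, `(M*B)ᵀ*(M*B)` is invertible and
`(M*B) * ((M*B)ᵀ*(M*B))⁻¹ * (M*B)ᵀ * M = M`: with probability `1` the projection of `M` onto the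
column space of `M*B` reproduces `M` exactly. -/
theorem stmt5 {m n r : ℕ} (hr1 : 1 ≤ r) (hrm : r ≤ m) (hrn : r ≤ n)
    (M : Matrix (Fin m) (Fin n) ℝ) (hrankM : M.rank = r) :
    ∀ᵐ B ∂(gaussianMatrix n r),
      IsUnit ((M * Matrix.of B)ᵀ * (M * Matrix.of B)) ∧
      (M * Matrix.of B) * ((M * Matrix.of B)ᵀ * (M * Matrix.of B))⁻¹ *
        (M * Matrix.of B)ᵀ * M = M := by
  have hdet : ∀ᵐ B ∂(gaussianMatrix n r), ((M * Matrix.of B)ᵀ * (M * Matrix.of B)).det ≠ 0 := by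
    have hcont : Continuous fun B : Fin n → Fin r → ℝ =>
        ((M * Matrix.of B)ᵀ * (M * Matrix.of B)).det := by
      have hof : Continuous fun B : Fin n → Fin r → ℝ => Matrix.of B := continuous_id
      fun_prop
    refine ae_pi_ne_zero_of_slices _ _ hcont.measurable (fun B i hne => ?_)
      (exists_gram_det_ne_zero M hrankM)
    refine ae_pi_ne_zero_of_slices (gaussianReal 0 1) _
      (hcont.comp (continuous_const.update i continuous_id)).measurable (fun b j hb => ?_) hne
    obtain ⟨p, hp⟩ := exists_polynomial_gram_det M B i b j
    simp only [← hp] at hb ⊢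
    have := nullSingletonClass_gaussianReal (μ := 0) (v := 1) one_ne_zero
    refine ae_eval_ne_zero _ p ?_
    rintro rfl
    simp at hb
  filter_upwards [hdet] with B hB
  have hunit := (isUnit_iff_isUnit_det _).2 hB.isUnit
  exact ⟨hunit, proj_mul_eq_self_of_isUnit_gram M hrankM _ hunit⟩
end

section
/- Let 1 ≤ r ≤ min(m,n), let B be a fixed real n×r matrix with rank(B) = r, let U be a random m×r Gaussian matrix and V an independent random r×n Gaussian matrix, and set M = UV. Then, almost surely, rank(MB) = r, the r×r matrix (MB)ᵀ(MB) is invertible, and (MB)((MB)ᵀ(MB))⁻¹(MB)ᵀM = M; that is, for almost every factor-Gaussian input M of expected rank r, projecting M onto the column space of MB reproduces M exactly. -/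
open MeasureTheory ProbabilityTheory Matrix

theorem measurePreserving_update {ι : Type*} [Fintype ι] [DecidableEq ι] {α : ι → Type*}
    [∀ i, MeasurableSpace (α i)] (μ : ∀ i, Measure (α i)) [∀ i, IsProbabilityMeasure (μ i)]
    (i : ι) :
    MeasurePreserving (fun z : (∀ j, α j) × α i => Function.update z.1 i z.2)
      ((Measure.pi μ).prod (μ i)) (Measure.pi μ) := by
  have hm : Measurable (fun z : (∀ j, α j) × α i => Function.update z.1 i z.2) :=
    measurable_update'
  refine ⟨hm, (Measure.pi_eq fun s hs => ?_).symm⟩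
  have h : (fun z : (∀ j, α j) × α i => Function.update z.1 i z.2) ⁻¹' Set.univ.pi s =
      (Set.univ.pi (Function.update s i Set.univ)) ×ˢ s i := by
    ext z
    simp only [Set.mem_preimage, Set.mem_pi, Set.mem_univ, true_imp_iff, Set.mem_prod]
    refine ⟨fun h => ⟨fun j => ?_, by simpa using h i⟩, fun h j => ?_⟩
    · rcases eq_or_ne j i with rfl | hj
      · simp
      · simpa [hj] using h j
    · rcases eq_or_ne j i with rfl | hj
      · simpa using h.2
      · simpa [hj] using h.1 j
  rw [Measure.map_apply hm (MeasurableSet.univ_pi hs), h, Measure.prod_prod, Measure.pi_pi,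
    ← Finset.mul_prod_erase _ _ (Finset.mem_univ i),
    ← Finset.mul_prod_erase _ (fun j => μ j (s j)) (Finset.mem_univ i)]
  simp only [Function.update_self, measure_univ, one_mul]
  rw [mul_comm]
  congr 1
  refine Finset.prod_congr rfl fun j hj => ?_
  rw [Function.update_of_ne (Finset.ne_of_mem_erase hj)]

/-- A measurable predicate that holds at one point, and that survives almost every change of a
single coordinate, holds almost everywhere for the product measure. -/
theorem ae_pi_of_forall_ae_update {ι : Type*} [Fintype ι] [DecidableEq ι] {α : ι → Type*}
    [∀ i, MeasurableSpace (α i)] (μ : ∀ i, Measure (α i)) [∀ i, IsProbabilityMeasure (μ i)]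
    {P : (∀ i, α i) → Prop} (hP : MeasurableSet {x | P x})
    (hupd : ∀ x i, P x → ∀ᵐ t ∂μ i, P (Function.update x i t)) {x₀ : ∀ i, α i} (h₀ : P x₀) :
    ∀ᵐ x ∂Measure.pi μ, P x := by
  suffices h : ∀ s : Finset ι, ∀ᵐ x ∂Measure.pi μ, P (s.piecewise x x₀) by
    simpa using h Finset.univ
  intro s
  induction s using Finset.induction_on with
  | empty => exact Filter.Eventually.of_forall fun _ => by simpa using h₀
  | insert i s hi ih =>
    have hm : Measurable fun x : ∀ i, α i => (insert i s).piecewise x x₀ := by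
      refine measurable_pi_iff.2 fun j => ?_
      by_cases hj : j ∈ insert i s
      · simpa only [Finset.piecewise_eq_of_mem _ _ _ hj] using measurable_pi_apply j
      · simpa only [Finset.piecewise_eq_of_notMem _ _ _ hj] using measurable_const
    have hmp := measurePreserving_update μ i
    rw [← hmp.map_eq, ae_map_iff (p := fun x => P ((insert i s).piecewise x x₀))
        hmp.measurable.aemeasurable (hm hP),
      Measure.ae_prod_iff_ae_ae
        (p := fun z => P ((insert i s).piecewise (Function.update z.1 i z.2) x₀))
        (hmp.measurable (hm hP))]
    filter_upwards [ih] with x hx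
    filter_upwards [hupd _ i hx] with t ht
    convert ht using 1
    ext j
    rcases eq_or_ne j i with rfl | hj
    · simp
    · by_cases hjs : j ∈ s <;> simp [hj, hjs]

/-- A continuous function on matrices that is polynomial in every single entry and does not vanish
identically is almost surely nonzero at a Gaussian matrix. -/
theorem ae_gaussianMatrix_ne_zero {p q : ℕ} {f : (Fin p → Fin q → ℝ) → ℝ} (hf : Continuous f)
    (hpoly : ∀ U i j, ∃ g : Polynomial ℝ, ∀ s : ℝ,
      f (Function.update U i (Function.update (U i) j s)) = g.eval s)
    {U₀ : Fin p → Fin q → ℝ} (h₀ : f U₀ ≠ 0) :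
    ∀ᵐ U ∂gaussianMatrix p q, f U ≠ 0 := by
  have : NullSingletonClass (gaussianReal 0 1) := nullSingletonClass_gaussianReal one_ne_zero
  refine ae_pi_of_forall_ae_update _ (P := fun U => f U ≠ 0)
    (isOpen_ne_fun hf continuous_const).measurableSet (fun U i hU => ?_) h₀
  refine ae_pi_of_forall_ae_update _ (P := fun u => f (Function.update U i u) ≠ 0) (x₀ := U i)
    (isOpen_ne_fun (hf.comp (continuous_const.update i continuous_id))
      continuous_const).measurableSet (fun u j hu => ?_) (by simpa using hU)
  obtain ⟨g, hg⟩ := hpoly (Function.update U i u) i j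
  simp only [Function.update_idem, Function.update_self] at hg
  have hg0 : g ≠ 0 := by
    rintro rfl
    exact hu (by simpa using hg (u j))
  have hroots : ∀ᵐ s ∂gaussianReal 0 1, s ∉ g.rootSet ℝ :=
    measure_eq_zero_iff_ae_notMem.1 ((g.rootSet_finite ℝ).measure_zero _)
  filter_upwards [hroots] with s hs
  rw [hg]
  exact fun h => hs ((Polynomial.mem_rootSet_of_ne hg0).2 (by simpa using h))

theorem ae_gaussianMatrix_det_mul_mul_ne_zero {p q r : ℕ} (C : Matrix (Fin r) (Fin p) ℝ)
    (B : Matrix (Fin q) (Fin r) ℝ) {U₀ : Matrix (Fin p) (Fin q) ℝ} (h₀ : (C * U₀ * B).det ≠ 0) :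
    ∀ᵐ U ∂gaussianMatrix p q, (C * Matrix.of U * B).det ≠ 0 := by
  refine ae_gaussianMatrix_ne_zero (f := fun U => (C * Matrix.of U * B).det) (U₀ := U₀)
    ?_ (fun U i j => ?_) h₀
  · exact ((continuous_const.matrix_mul continuous_id).matrix_mul continuous_const).matrix_det
  · refine ⟨(Matrix.of fun k l => Polynomial.C
        ((C * Matrix.of (Function.update U i (Function.update (U i) j 0)) * B) k l) +
      Polynomial.X * Polynomial.C
        ((C * Matrix.single i j (1 : ℝ) * B) k l)).det, fun s => ?_⟩
    rw [← Polynomial.coe_evalRingHom, RingHom.map_det]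
    have h : Matrix.of (Function.update U i (Function.update (U i) j s)) =
        Matrix.of (Function.update U i (Function.update (U i) j 0)) +
          s • Matrix.single i j (1 : ℝ) := by
      ext k l
      rcases eq_or_ne k i with rfl | hk
      · rcases eq_or_ne l j with rfl | hl
        · simp
        · simp [hl, hl.symm]
      · simp [hk, hk.symm]
    rw [h]
    congr 1
    ext k l
    simp [Matrix.mul_add, Matrix.add_mul, -Matrix.smul_single, mul_comm s]

theorem isUnit_of_rank_eq {r : ℕ} {A : Matrix (Fin r) (Fin r) ℝ} (h : A.rank = r) :
    IsUnit A := by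
  rw [← Matrix.linearIndependent_cols_iff_isUnit, linearIndependent_iff_card_eq_finrank_span,
    Set.finrank, ← Matrix.rank_eq_finrank_span_cols, h, Fintype.card_fin]

/-- Let `1 ≤ r ≤ min(m,n)`, let `B` be a fixed real `n×r` matrix of rank `r`,
and let `U`, `V` be independent Gaussian matrices of sizes `m×r` and `r×n`; set `M = U*V`.
Then almost surely `rank (M*B) = r`, `(M*B)ᵀ*(M*B)` is invertible, and
`(M*B) * ((M*B)ᵀ*(M*B))⁻¹ * (M*B)ᵀ * M = M`. -/
theorem stmt6 {m n r : ℕ} (hr1 : 1 ≤ r) (hrm : r ≤ m) (hrn : r ≤ n)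
    (B : Matrix (Fin n) (Fin r) ℝ) (hB : B.rank = r) :
    ∀ᵐ p ∂((gaussianMatrix m r).prod (gaussianMatrix r n)),
      (Matrix.of p.1 * Matrix.of p.2 * B).rank = r ∧
      IsUnit ((Matrix.of p.1 * Matrix.of p.2 * B)ᵀ * (Matrix.of p.1 * Matrix.of p.2 * B)) ∧
      (Matrix.of p.1 * Matrix.of p.2 * B) *
        ((Matrix.of p.1 * Matrix.of p.2 * B)ᵀ * (Matrix.of p.1 * Matrix.of p.2 * B))⁻¹ *
        (Matrix.of p.1 * Matrix.of p.2 * B)ᵀ * (Matrix.of p.1 * Matrix.of p.2) =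
      Matrix.of p.1 * Matrix.of p.2 := by
  have hU : ∀ᵐ U ∂gaussianMatrix m r,
      ((1 : Matrix (Fin m) (Fin m) ℝ).submatrix (Fin.castLE hrm) id * Matrix.of U * 1).det ≠ 0 := by
    refine ae_gaussianMatrix_det_mul_mul_ne_zero _ _
      (U₀ := (1 : Matrix (Fin m) (Fin m) ℝ).submatrix id (Fin.castLE hrm)) ?_
    rw [← Matrix.submatrix_mul _ _ _ _ _ Function.bijective_id, Matrix.one_mul, Matrix.mul_one,
      Matrix.submatrix_one _ (Fin.castLE_injective hrm), Matrix.det_one]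
    exact one_ne_zero
  have hV : ∀ᵐ V ∂gaussianMatrix r n, ((1 : Matrix (Fin r) (Fin r) ℝ) * Matrix.of V * B).det ≠ 0 := by
    refine ae_gaussianMatrix_det_mul_mul_ne_zero _ _ (U₀ := Bᵀ) ?_
    rw [Matrix.one_mul]
    have := isUnit_of_rank_eq ((Matrix.rank_transpose_mul_self B).trans hB)
    exact ((Matrix.isUnit_iff_isUnit_det _).1 this).ne_zero
  filter_upwards [Measure.quasiMeasurePreserving_fst.ae hU,
    Measure.quasiMeasurePreserving_snd.ae hV] with ⟨U, V⟩ hU hV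
  rw [Matrix.mul_one] at hU
  rw [Matrix.one_mul] at hV
  dsimp only at hU hV ⊢
  have hVB : IsUnit (Matrix.of V * B).det := hV.isUnit
  have hrank : (Matrix.of U * Matrix.of V * B).rank = r := by
    rw [Matrix.mul_assoc, Matrix.rank_mul_eq_left_of_isUnit_det _ _ hVB]
    refine le_antisymm (Matrix.rank_le_width _) ?_
    have h := Matrix.rank_of_isUnit _ ((Matrix.isUnit_iff_isUnit_det _).2 hU.isUnit)
    rw [Fintype.card_fin] at h
    exact h.symm.le.trans (Matrix.rank_mul_le_right _ _)
  have hunit := isUnit_of_rank_eq ((Matrix.rank_transpose_mul_self _).trans hrank)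
  refine ⟨hrank, hunit, ?_⟩
  have hUA : Matrix.of U = Matrix.of U * Matrix.of V * B * (Matrix.of V * B)⁻¹ := by
    rw [Matrix.mul_assoc (Matrix.of U), Matrix.mul_nonsing_inv_cancel_right _ _ hVB]
  generalize Matrix.of U * Matrix.of V * B = A at hunit hUA ⊢
  rw [hUA, Matrix.mul_assoc A (Matrix.of V * B)⁻¹, ← Matrix.mul_assoc _ A,
    Matrix.mul_assoc (A * (Aᵀ * A)⁻¹) Aᵀ A,
    Matrix.nonsing_inv_mul_cancel_right _ _ ((Matrix.isUnit_iff_isUnit_det _).1 hunit)]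
end

section
/- Let 1 ≤ r ≤ min(m,n), let U be a random m×r Gaussian matrix and V an independent random r×n Gaussian matrix. Then rank(UV) = r almost surely; that is, a factor-Gaussian m×n matrix of expected rank r has rank exactly r with probability 1. -/
open MeasureTheory ProbabilityTheory

/-- A product of atomless measures on `ℝ` does not charge proper subspaces. -/
theorem MeasureTheory.Measure.pi_ae_notMem_of_lt_top {q : ℕ} (μ : Measure ℝ) [SigmaFinite μ]
    [NullSingletonClass μ] {W : Submodule ℝ (Fin q → ℝ)} (hW : W < ⊤) :
    ∀ᵐ x ∂(Measure.pi fun _ : Fin q => μ), x ∉ W := by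
  obtain ⟨φ, hφ, hle⟩ := W.exists_le_ker_of_lt_top hW
  have hcont : Continuous φ := φ.continuous_of_finiteDimensional
  obtain ⟨i, hi⟩ : ∃ i, φ (Pi.single i 1) ≠ 0 := by
    by_contra! h
    exact hφ (LinearMap.pi_ext' fun i => LinearMap.ext_ring (by simpa using h i))
  suffices h : ∀ᵐ x ∂(Measure.pi fun _ : Fin q => μ), φ x ≠ 0 by
    filter_upwards [h] with x hx hxW using hx (hle hxW)
  obtain _ | n := q
  · exact i.elim0
  have hmeas : MeasurableSet {z : ℝ × (Fin n → ℝ) | φ (i.insertNth z.1 z.2) ≠ 0} := by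
    refine (isOpen_ne_fun (hcont.comp ?_) continuous_const).measurableSet
    fun_prop
  have key : ∀ᵐ z ∂μ.prod (Measure.pi fun _ : Fin n => μ), φ (i.insertNth z.1 z.2) ≠ 0 := by
    rw [Measure.ae_prod_iff_ae_ae hmeas, Measure.ae_ae_comm hmeas]
    refine Filter.Eventually.of_forall fun y => ?_
    rw [ae_iff]
    refine Set.Subsingleton.measure_zero ?_ μ
    intro a ha b hb
    simp only [ne_eq, not_not, Set.mem_ofPred_eq] at ha hb
    have hsub : (i.insertNth a y : Fin (n + 1) → ℝ) - i.insertNth b y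
        = (a - b) • (Pi.single i 1 : Fin (n + 1) → ℝ) := by
      ext j
      refine i.succAboveCases ?_ (fun k => ?_) j <;> simp
    have := congrArg φ hsub
    rw [map_sub, ha, hb, map_smul, sub_zero, smul_eq_mul, eq_comm, mul_eq_zero] at this
    exact sub_eq_zero.1 (this.resolve_right hi)
  filter_upwards [(measurePreserving_piFinSuccAbove (fun _ : Fin (n + 1) => μ) i)
    |>.quasiMeasurePreserving.ae key] with x hx
  have hx' : φ (i.insertNth (x i) (i.removeNth x)) ≠ 0 := hx
  rwa [Fin.insertNth_self_removeNth] at hx'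

section IndependentRows

variable {q : ℕ} (μ : Measure (Fin q → ℝ)) [SigmaFinite μ]

/-- At most `q` independent samples from a measure on `ℝ^q` not charging proper subspaces are
almost surely linearly independent. -/
theorem MeasureTheory.Measure.pi_ae_linearIndependent
    (hμ : ∀ W : Submodule ℝ (Fin q → ℝ), W < ⊤ → ∀ᵐ x ∂μ, x ∉ W) {p : ℕ} (hpq : p ≤ q) :
    ∀ᵐ v ∂(Measure.pi fun _ : Fin p => μ), LinearIndependent ℝ v := by
  induction p with
  | zero => exact Filter.Eventually.of_forall fun v => linearIndependent_empty_type
  | succ p ih =>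
    have hmeas : MeasurableSet {z : (Fin q → ℝ) × (Fin p → Fin q → ℝ) |
        LinearIndependent ℝ (Fin.cons z.1 z.2 : Fin (p + 1) → Fin q → ℝ)} := by
      refine (isOpen_setOfPred_linearIndependent.preimage (f := fun z :
        (Fin q → ℝ) × (Fin p → Fin q → ℝ) => (Fin.cons z.1 z.2 : Fin (p + 1) → Fin q → ℝ))
        ?_).measurableSet
      fun_prop
    have key : ∀ᵐ z ∂μ.prod (Measure.pi fun _ : Fin p => μ),
        LinearIndependent ℝ (Fin.cons z.1 z.2 : Fin (p + 1) → Fin q → ℝ) := by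
      rw [Measure.ae_prod_iff_ae_ae hmeas, Measure.ae_ae_comm hmeas]
      filter_upwards [ih (by omega)] with v hv
      have hlt : Submodule.span ℝ (Set.range v) < ⊤ := by
        refine Submodule.lt_top_of_finrank_lt_finrank ?_
        rw [finrank_span_eq_card hv]
        simpa using hpq
      filter_upwards [hμ _ hlt] with x hx
      exact linearIndependent_finCons.2 ⟨hv, hx⟩
    filter_upwards [(measurePreserving_piFinSuccAbove (fun _ : Fin (p + 1) => μ) 0)
      |>.quasiMeasurePreserving.ae key] with x hx
    simpa [MeasurableEquiv.piFinSuccAbove] using hx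

/-- At least `q` independent samples from a measure on `ℝ^q` not charging proper subspaces
almost surely span `ℝ^q`. -/
theorem MeasureTheory.Measure.pi_ae_span_eq_top
    (hμ : ∀ W : Submodule ℝ (Fin q → ℝ), W < ⊤ → ∀ᵐ x ∂μ, x ∉ W) {p : ℕ} (hqp : q ≤ p) :
    ∀ᵐ v ∂(Measure.pi fun _ : Fin p => μ), Submodule.span ℝ (Set.range v) = ⊤ := by
  induction p, hqp using Nat.le_induction with
  | base =>
    filter_upwards [Measure.pi_ae_linearIndependent μ hμ le_rfl] with v hv
    exact hv.span_eq_top_of_card_eq_finrank' (by simp)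
  | succ p _ ih =>
    have key := (Measure.quasiMeasurePreserving_snd (μ := μ)
      (ν := Measure.pi fun _ : Fin p => μ)).ae ih
    filter_upwards [(measurePreserving_piFinSuccAbove (fun _ : Fin (p + 1) => μ) 0)
      |>.quasiMeasurePreserving.ae key] with x hx
    refine top_unique (hx.symm.le.trans (Submodule.span_mono ?_))
    rintro _ ⟨j, rfl⟩
    exact ⟨j.succ, rfl⟩

end IndependentRows

/-- If the rows of `B` are linearly independent, right multiplication by `B` preserves rank. -/
theorem Matrix.rank_mul_eq_left_of_linearIndependent_row {l m n K : Type*} [Fintype m] [Fintype n]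
    [Field K] (A : Matrix l m K) {B : Matrix m n K} (hB : LinearIndependent K B.row) :
    (A * B).rank = A.rank := by
  have hsurj : LinearMap.range B.mulVecLin = ⊤ := by
    refine Submodule.eq_top_of_finrank_eq ?_
    rw [Module.finrank_fintype_fun_eq_card]
    exact hB.rank_matrix
  rw [Matrix.rank, Matrix.rank, Matrix.mulVecLin_mul, LinearMap.range_comp, hsurj,
    Submodule.map_top]

/-- Let `1 ≤ r ≤ min(m,n)`, and let `U`, `V` be independent Gaussian matrices of
sizes `m×r` and `r×n`.  Then `rank (U*V) = r` almost surely: a factor-Gaussian `m×n` matrix of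
expected rank `r` has rank exactly `r` with probability `1`. -/
theorem stmt7 {m n r : ℕ} (hr1 : 1 ≤ r) (hrm : r ≤ m) (hrn : r ≤ n) :
    ∀ᵐ p ∂((gaussianMatrix m r).prod (gaussianMatrix r n)),
      (Matrix.of p.1 * Matrix.of p.2).rank = r := by
  have : NullSingletonClass (gaussianReal 0 1) := nullSingletonClass_gaussianReal one_ne_zero
  have hU : ∀ᵐ u ∂gaussianMatrix m r, Submodule.span ℝ (Set.range u) = ⊤ :=
    Measure.pi_ae_span_eq_top _ (fun _ => Measure.pi_ae_notMem_of_lt_top (gaussianReal 0 1)) hrm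
  have hV : ∀ᵐ v ∂gaussianMatrix r n, LinearIndependent ℝ v :=
    Measure.pi_ae_linearIndependent _ (fun _ => Measure.pi_ae_notMem_of_lt_top (gaussianReal 0 1)) hrn
  have : SFinite (gaussianMatrix r n) := by unfold gaussianMatrix; infer_instance
  filter_upwards [Measure.quasiMeasurePreserving_fst.ae hU,
    Measure.quasiMeasurePreserving_snd.ae hV] with p hp₁ hp₂
  rw [Matrix.rank_mul_eq_left_of_linearIndependent_row (B := Matrix.of p.2) _ hp₂,
    Matrix.rank_eq_finrank_span_row]
  change Module.finrank ℝ (Submodule.span ℝ (Set.range p.1)) = r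
  rw [hp₁, finrank_top, Module.finrank_fin_fun]
end
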